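/- Let Λ be the logistic measure on ℝ with density f(x) = e^x/(1+e^x)², and let Λ^{N+1} be its (N+1)-fold product on ℝ^{N+1}. For a unit vector v ∈ S^N and t ∈ ℝ, the half-space H^{N+1}_{v,t} = {x ∈ ℝ^{N+1} : ⟨x,v⟩ < t} is stationary for Λ^{N+1} if and only if either H^{N+1}_{v,t} is a coordinate half-space, or v ∈ V_N and t = 0. -/

import Mathlib

open MeasureTheory Real

/-- The logistic density `f(x) = eˣ/(1+eˣ)²`. -/
noncomputable def logisticDensity (x : ℝ) : ℝ := Real.exp x / (1 + Real.exp x) ^ 2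

/-- The log-density `ψ = ln f` of the logistic measure. -/
noncomputable def logisticPsi (x : ℝ) : ℝ := Real.log (logisticDensity x)

/-- `v ∈ V_n`: exactly two non-zero coordinates, both of absolute value `1/√2`. -/
def memV {n : ℕ} (v : Fin n → ℝ) : Prop :=
  ∃ i j, i ≠ j ∧ (∀ k, k ≠ i → k ≠ j → v k = 0) ∧
    |v i| = (Real.sqrt 2)⁻¹ ∧ |v j| = (Real.sqrt 2)⁻¹

theorem hasDerivAt_logisticPsi (x : ℝ) :
    HasDerivAt logisticPsi (2 / (1 + Real.exp x) - 1) x := by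
  have hpsi : logisticPsi = fun y => y - 2 * Real.log (1 + Real.exp y) := by
    funext y
    have hy : 1 + Real.exp y ≠ 0 := by positivity
    simp [logisticPsi, logisticDensity, Real.log_div (Real.exp_ne_zero y) (pow_ne_zero 2 hy)]
  have hx : 1 + Real.exp x ≠ 0 := by positivity
  rw [hpsi]
  refine ((hasDerivAt_id x).sub
    ((((Real.hasDerivAt_exp x).const_add 1).log hx).const_mul 2)).congr_deriv ?_
  field_simp
  ring

theorem deriv_logisticPsi (x : ℝ) : deriv logisticPsi x = 2 / (1 + Real.exp x) - 1 :=
  (hasDerivAt_logisticPsi x).deriv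

theorem deriv_logisticPsi_neg (x : ℝ) : deriv logisticPsi (-x) = -deriv logisticPsi x := by
  rw [deriv_logisticPsi, deriv_logisticPsi, Real.exp_neg]
  have hx := Real.exp_pos x
  field_simp
  ring

theorem hasDerivAt_deriv_logisticPsi (x : ℝ) :
    HasDerivAt (deriv logisticPsi) (-2 * logisticDensity x) x := by
  have hx : 1 + Real.exp x ≠ 0 := by positivity
  rw [funext deriv_logisticPsi]
  refine (((hasDerivAt_const x (2 : ℝ)).div
    ((Real.hasDerivAt_exp x).const_add 1) hx).sub_const 1).congr_deriv ?_
  simp only [logisticDensity]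
  ring

theorem abs_eq_abs_of_logisticDensity_eq {p q : ℝ}
    (h : logisticDensity p = logisticDensity q) : |p| = |q| := by
  have hp : 1 + Real.exp p ≠ 0 := by positivity
  have hq : 1 + Real.exp q ≠ 0 := by positivity
  unfold logisticDensity at h
  rw [div_eq_div_iff (pow_ne_zero 2 hp) (pow_ne_zero 2 hq)] at h
  have hmul : (Real.exp p - Real.exp q) * (Real.exp (p + q) - 1) = 0 := by
    rw [Real.exp_add]
    linear_combination -h
  rw [abs_eq_abs]
  rcases mul_eq_zero.mp hmul with h | h
  · exact Or.inl (Real.exp_injective (sub_eq_zero.mp h))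
  · have := Real.exp_eq_one_iff (p + q) |>.mp (sub_eq_zero.mp h)
    exact Or.inr (by linarith)

/-- On a hyperplane of constant mean curvature, the coordinates that its normal charges agree in
absolute value. -/
theorem abs_eq_abs_of_stationary {ι : Type*} [Fintype ι] [DecidableEq ι] {v : ι → ℝ} {t c : ℝ}
    (h : ∀ x : ι → ℝ, (∑ i, x i * v i) = t → -(∑ i, deriv logisticPsi (x i) * v i) = c)
    {i j : ι} (hi : v i ≠ 0) (hj : v j ≠ 0) {x : ι → ℝ}
    (hx : (∑ i, x i * v i) = t) : |x i| = |x j| := by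
  set w : ι → ℝ := Pi.single i (v j) - Pi.single j (v i) with hw
  have sum_w (g : ι → ℝ) : ∑ k, w k * g k = v j * g i - v i * g j := by
    simp [hw, sub_mul, Finset.sum_sub_distrib, Pi.single_apply, ite_mul]
  have hconst (s : ℝ) : ∑ k, deriv logisticPsi (x k + s * w k) * v k = -c := by
    rw [← h (fun k => x k + s * w k), neg_neg]
    simp only [add_mul, Finset.sum_add_distrib, mul_assoc, ← Finset.mul_sum, sum_w, hx]
    ring
  have hderiv : HasDerivAt (fun s : ℝ => ∑ k, deriv logisticPsi (x k + s * w k) * v k)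
      (∑ k, w k * (-2 * logisticDensity (x k) * v k)) 0 := by
    refine HasDerivAt.fun_sum fun k _ => ?_
    have hline : HasDerivAt (fun s : ℝ => x k + s * w k) (w k) 0 := by
      simpa using ((hasDerivAt_id (0 : ℝ)).mul_const (w k)).const_add (x k)
    have hpsi : HasDerivAt (deriv logisticPsi) (-2 * logisticDensity (x k)) (x k + 0 * w k) := by
      simpa using hasDerivAt_deriv_logisticPsi (x k)
    refine ((hpsi.comp (0 : ℝ) hline).mul_const (v k)).congr_deriv ?_
    ring
  rw [funext hconst, sum_w] at hderiv
  have hzero := hderiv.unique (hasDerivAt_const (0 : ℝ) (-c))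
  have hprod : v i * v j * (logisticDensity (x i) - logisticDensity (x j)) = 0 := by
    linear_combination -hzero / 2
  exact abs_eq_abs_of_logisticDensity_eq
    (sub_eq_zero.mp ((mul_eq_zero.mp hprod).resolve_left (mul_ne_zero hi hj)))

/-- If on a hyperplane all coordinates charged by its normal agree in absolute value and the unit
normal charges at least two of them, then the normal lies in `V_N` and the hyperplane passes
through the origin. -/
theorem memV_and_eq_zero_of_abs_eq_abs {n : ℕ} {v : Fin n → ℝ} (hv : ∑ i, v i ^ 2 = 1) {t : ℝ}
    (h : ∀ i j, v i ≠ 0 → v j ≠ 0 → ∀ x : Fin n → ℝ, (∑ i, x i * v i) = t → |x i| = |x j|)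
    {i j : Fin n} (hij : i ≠ j) (hi : v i ≠ 0) (hj : v j ≠ 0) : memV v ∧ t = 0 := by
  have sum_two (k l : Fin n) (a b : ℝ) :
      ∑ m, (Pi.single k a + Pi.single l b : Fin n → ℝ) m * v m = a * v k + b * v l := by
    simp [add_mul, Finset.sum_add_distrib, Pi.single_apply, ite_mul]
  have hsupp (k : Fin n) (hki : k ≠ i) (hkj : k ≠ j) : v k = 0 := by
    by_contra hk
    have hx := h i j hi hj (Pi.single i 1 + Pi.single k ((t - v i) / v k))
      (by rw [sum_two]; field_simp; ring)
    simp [hij.symm, hki.symm, hkj.symm] at hx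
  have ht : t = 0 := by
    have hx := h i j hi hj (Pi.single i 0 + Pi.single j (t / v j))
      (by rw [sum_two]; field_simp; ring)
    simpa [hij, hij.symm, hj, eq_comm] using hx
  have habs : |v j| = |v i| := by
    have hx := h i j hi hj (Pi.single i (v j) + Pi.single j (-v i))
      (by rw [sum_two, ht]; ring)
    simpa [hij, hij.symm] using hx
  have hsum : v i ^ 2 + v j ^ 2 = 1 := by
    rw [← hv]
    symm
    exact Fintype.sum_eq_add i j hij fun k hk => by simp [hsupp k hk.1 hk.2]
  have hsq : v j ^ 2 = v i ^ 2 := sq_eq_sq_iff_abs_eq_abs _ _ |>.mpr habs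
  have hval : |v i| = (Real.sqrt 2)⁻¹ := by
    rw [← Real.sqrt_sq_eq_abs, ← Real.sqrt_inv]
    congr 1
    linarith
  exact ⟨⟨i, j, hij, hsupp, hval, habs.trans hval⟩, ht⟩

/-- Stationary half-spaces for powers of the logistic measure: the half-space
`H = {x ∈ ℝ^{N+1} : ⟨x,v⟩ < t}` is stationary for `Λ^{N+1}` (i.e. the generalized mean
curvature `-∑ᵢ ψ'(xᵢ) vᵢ`, with `ψ = ln f`, is constant on the boundary hyperplane)
if and only if it is a coordinate half-space, or `v ∈ V_N` and `t = 0`. -/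
theorem logistic_stationary_halfspaces
    (N : ℕ) (v : Fin (N + 1) → ℝ) (hv : ∑ i, v i ^ 2 = 1) (t : ℝ) :
    (∃ c : ℝ, ∀ x : Fin (N + 1) → ℝ, (∑ i, x i * v i) = t →
        -(∑ i, deriv logisticPsi (x i) * v i) = c)
    ↔ ((∃ i, v i ≠ 0 ∧ ∀ j, j ≠ i → v j = 0) ∨ (memV v ∧ t = 0)) := by
  constructor
  · rintro ⟨c, hc⟩
    obtain ⟨i, hi⟩ : ∃ i, v i ≠ 0 := by
      by_contra! h0
      simp [h0] at hv
    by_cases hcoord : ∀ j, j ≠ i → v j = 0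
    · exact Or.inl ⟨i, hi, hcoord⟩
    · push Not at hcoord
      obtain ⟨j, hji, hj⟩ := hcoord
      exact Or.inr (memV_and_eq_zero_of_abs_eq_abs hv
        (fun _ _ hk hl _ hx => abs_eq_abs_of_stationary hc hk hl hx) hji.symm hi hj)
  · rintro (⟨i, hi, hsupp⟩ | ⟨⟨i, j, hij, hsupp, hvi, hvj⟩, rfl⟩)
    · have hsum (g : Fin (N + 1) → ℝ) : ∑ k, g k * v k = g i * v i :=
        Fintype.sum_eq_single i fun k hk => by simp [hsupp k hk]
      refine ⟨-(deriv logisticPsi (t / v i) * v i), fun x hx => ?_⟩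
      rw [hsum] at hx
      rw [hsum fun k => deriv logisticPsi (x k), eq_div_of_mul_eq hi hx]
    · have hsum (g : Fin (N + 1) → ℝ) : ∑ k, g k * v k = g i * v i + g j * v j :=
        Fintype.sum_eq_add i j hij fun k hk => by simp [hsupp k hk.1 hk.2]
      have hi : v i ≠ 0 := abs_pos.mp (hvi ▸ by positivity)
      refine ⟨0, fun x hx => ?_⟩
      rw [hsum] at hx
      rw [hsum fun k => deriv logisticPsi (x k)]
      rcases abs_eq_abs.mp (hvj.trans hvi.symm) with hvv | hvv
      · rw [hvv] at hx ⊢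
        have hxx : x j = -x i := mul_right_cancel₀ hi (by linarith)
        rw [hxx, deriv_logisticPsi_neg]
        ring
      · rw [hvv] at hx ⊢
        have hxx : x j = x i := mul_right_cancel₀ hi (by linarith)
        rw [hxx]
        ring
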